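/- arXiv:math/9809025 — 3 statements merged into one kernel-verified Lean document; each statement's English description precedes it below -/
import Mathlib

section
/- Let G be a group, c : G × ℤ_{>0} × ℤ_{>0} → ℂ, and F : ℤ_{>0} × G × ℤ_{>0} → ℂ. Suppose that for all g ∈ G and m,n ≥ 1: ∑_{k | gcd(m,n)} (1/k)·c(g^k, m/k, n/k) = ∑_{a | gcd(m,n)} (1/a)·F(a, g, mn/a²). Then for all g ∈ G and m,n ≥ 1: c(g,m,n) = ∑_{(a,d) ∈ ℤ_{>0}×ℤ_{>0}, ad | gcd(m,n)} (1/(ad))·μ(d)·F(a, g^d, mn/(a²d²)), where μ is the classical Möbius function. -/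
theorem aux_pairs_sum (N : ℕ) (hN : N ≠ 0) (f : ℕ → ℕ → ℂ) :
    ∑ p ∈ (N.divisors ×ˢ N.divisors).filter (fun p => p.1 * p.2 ∣ N), f p.1 p.2
      = ∑ d ∈ N.divisors, ∑ a ∈ (N / d).divisors, f a d := by
  rw [Finset.sum_filter, Finset.sum_product_right]
  refine Finset.sum_congr rfl fun d hd => ?_
  have hd' := Nat.dvd_of_mem_divisors hd
  rw [← Finset.sum_filter]
  refine Finset.sum_congr ?_ fun _ _ => rfl
  obtain ⟨e, rfl⟩ := hd'
  have hd0 : 0 < d := Nat.pos_of_ne_zero (by rintro rfl; simp at hN)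
  have he0 : e ≠ 0 := by rintro rfl; simp at hN
  ext a
  simp only [Finset.mem_filter, Nat.mem_divisors, Nat.mul_div_cancel_left e hd0]
  constructor
  · rintro ⟨_, h⟩
    rw [mul_comm a d] at h
    exact ⟨Nat.dvd_of_mul_dvd_mul_left hd0 h, he0⟩
  · rintro ⟨h, _⟩
    refine ⟨⟨h.mul_left d, hN⟩, ?_⟩
    rw [mul_comm a d]
    exact Nat.mul_dvd_mul_left d h

theorem aux_pairs_fiber (N : ℕ) (hN : N ≠ 0) (f : ℕ → ℕ → ℂ) :
    ∑ p ∈ (N.divisors ×ˢ N.divisors).filter (fun p => p.1 * p.2 ∣ N), f p.1 p.2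
      = ∑ e ∈ N.divisors, ∑ p ∈ e.divisorsAntidiagonal, f p.1 p.2 := by
  rw [← Finset.sum_fiberwise_of_maps_to (g := fun p : ℕ × ℕ => p.1 * p.2) (t := N.divisors)]
  · refine Finset.sum_congr rfl fun e he => ?_
    have he' := Nat.dvd_of_mem_divisors he
    refine Finset.sum_congr ?_ fun _ _ => rfl
    ext ⟨a, d⟩
    simp only [Finset.mem_filter, Finset.mem_product, Nat.mem_divisors,
      Nat.mem_divisorsAntidiagonal]
    constructor
    · rintro ⟨_, rfl⟩
      exact ⟨rfl, ne_zero_of_dvd_ne_zero hN he'⟩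
    · rintro ⟨rfl, _⟩
      exact ⟨⟨⟨⟨(Dvd.intro _ rfl).trans he', hN⟩, ⟨(Dvd.intro_left _ rfl).trans he', hN⟩⟩, he'⟩, rfl⟩
  · intro p hp
    exact Nat.mem_divisors.2 ⟨(Finset.mem_filter.1 hp).2, hN⟩

/-- Möbius-inversion core of Corollary 7.2 for replicable functions.
If for all `g ∈ G` and `m, n ≥ 1` one has
`∑_{k | gcd(m,n)} (1/k) c(g^k, m/k, n/k) = ∑_{a | gcd(m,n)} (1/a) F(a, g, mn/a²)`,
then for all `g ∈ G` and `m, n ≥ 1`,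
`c(g,m,n) = ∑_{(a,d) : ad | gcd(m,n)} (1/(ad)) μ(d) F(a, g^d, mn/(a²d²))`. -/
theorem moebius_inversion_replicable
    {G : Type*} [Group G]
    (c : G → ℕ → ℕ → ℂ) (F : ℕ → G → ℕ → ℂ)
    (hyp : ∀ (g : G) (m n : ℕ), 0 < m → 0 < n →
      ∑ k ∈ (Nat.gcd m n).divisors, ((k : ℂ)⁻¹) * c (g ^ k) (m / k) (n / k)
        = ∑ a ∈ (Nat.gcd m n).divisors, ((a : ℂ)⁻¹) * F a g (m * n / a ^ 2)) :
    ∀ (g : G) (m n : ℕ), 0 < m → 0 < n →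
      c g m n
        = ∑ p ∈ ((Nat.gcd m n).divisors ×ˢ (Nat.gcd m n).divisors).filter
            (fun p => p.1 * p.2 ∣ Nat.gcd m n),
          (((p.1 * p.2 : ℕ) : ℂ)⁻¹) * ((ArithmeticFunction.moebius p.2 : ℤ) : ℂ)
            * F p.1 (g ^ p.2) (m * n / (p.1 ^ 2 * p.2 ^ 2)) := by
  intro g m n hm hn
  have hN : Nat.gcd m n ≠ 0 := (Nat.gcd_pos_of_pos_left n hm).ne'
  rw [aux_pairs_sum _ hN (fun a d => (((a * d : ℕ) : ℂ)⁻¹) *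
    ((ArithmeticFunction.moebius d : ℤ) : ℂ) * F a (g ^ d) (m * n / (a ^ 2 * d ^ 2)))]
  have key : ∀ d ∈ (Nat.gcd m n).divisors,
      ∑ a ∈ (Nat.gcd m n / d).divisors, (((a * d : ℕ) : ℂ)⁻¹) *
        ((ArithmeticFunction.moebius d : ℤ) : ℂ) * F a (g ^ d) (m * n / (a ^ 2 * d ^ 2))
      = ∑ k ∈ (Nat.gcd m n / d).divisors, ((ArithmeticFunction.moebius d : ℤ) : ℂ) *
        ((((k * d : ℕ) : ℂ)⁻¹) * c (g ^ (k * d)) (m / (k * d)) (n / (k * d))) := by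
    intro d hd
    have hdN := Nat.dvd_of_mem_divisors hd
    have hd0 : 0 < d := Nat.pos_of_mem_divisors hd
    have hdm := hdN.trans (Nat.gcd_dvd_left m n)
    have hdn := hdN.trans (Nat.gcd_dvd_right m n)
    have h := hyp (g ^ d) (m / d) (n / d) (Nat.div_pos (Nat.le_of_dvd hm hdm) hd0)
      (Nat.div_pos (Nat.le_of_dvd hn hdn) hd0)
    rw [Nat.gcd_div hdm hdn] at h
    have h2 := congrArg
      (fun x => ((ArithmeticFunction.moebius d : ℤ) : ℂ) * (d : ℂ)⁻¹ * x) h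
    simp only [Finset.mul_sum] at h2
    refine Eq.trans ?_ (h2.symm.trans ?_)
    · refine Finset.sum_congr rfl fun a _ => ?_
      have e : m / d * (n / d) / a ^ 2 = m * n / (a ^ 2 * d ^ 2) := by
        rw [Nat.div_mul_div_comm hdm hdn, Nat.div_div_eq_div_mul]
        congr 1
        ring
      rw [e]
      push_cast
      rw [mul_inv]
      ring
    · refine Finset.sum_congr rfl fun k _ => ?_
      rw [Nat.div_div_eq_div_mul, Nat.div_div_eq_div_mul, ← pow_mul, mul_comm d k]
      push_cast
      rw [mul_inv]
      ring
  rw [Finset.sum_congr rfl key, ← aux_pairs_sum _ hN (fun k d =>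
    ((ArithmeticFunction.moebius d : ℤ) : ℂ) *
        ((((k * d : ℕ) : ℂ)⁻¹) * c (g ^ (k * d)) (m / (k * d)) (n / (k * d)))),
    aux_pairs_fiber _ hN (fun k d => ((ArithmeticFunction.moebius d : ℤ) : ℂ) *
        ((((k * d : ℕ) : ℂ)⁻¹) * c (g ^ (k * d)) (m / (k * d)) (n / (k * d))))]
  have inner : ∀ e ∈ (Nat.gcd m n).divisors,
      ∑ p ∈ e.divisorsAntidiagonal, ((ArithmeticFunction.moebius p.2 : ℤ) : ℂ) *
        ((((p.1 * p.2 : ℕ) : ℂ)⁻¹) *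
          c (g ^ (p.1 * p.2)) (m / (p.1 * p.2)) (n / (p.1 * p.2)))
      = if e = 1 then c g m n else 0 := by
    intro e _
    have h1 : ∑ p ∈ e.divisorsAntidiagonal, ((ArithmeticFunction.moebius p.2 : ℤ) : ℂ) *
        ((((p.1 * p.2 : ℕ) : ℂ)⁻¹) *
          c (g ^ (p.1 * p.2)) (m / (p.1 * p.2)) (n / (p.1 * p.2)))
        = ∑ p ∈ e.divisorsAntidiagonal, ((ArithmeticFunction.moebius p.2 : ℤ) : ℂ) *
        (((e : ℂ)⁻¹) * c (g ^ e) (m / e) (n / e)) := by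
      refine Finset.sum_congr rfl fun p hp => ?_
      rw [(Nat.mem_divisorsAntidiagonal.1 hp).1]
    have h2 : ∑ p ∈ e.divisorsAntidiagonal, ArithmeticFunction.moebius p.2
        = if e = 1 then 1 else 0 := by
      rw [Nat.sum_divisorsAntidiagonal' (fun _ j => ArithmeticFunction.moebius j),
        ← ArithmeticFunction.coe_zeta_mul_apply, ArithmeticFunction.coe_zeta_mul_moebius,
        ArithmeticFunction.one_apply]
    rw [h1, ← Finset.sum_mul, ← Int.cast_sum, h2]
    split_ifs with he
    · subst he
      simp
    · simp
  rw [Finset.sum_congr rfl inner, Finset.sum_ite_eq' _ 1, if_pos (Nat.one_mem_divisors.2 hN)]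
end

section
/- Let I be a type, σ : I ≃ I a bijection, and A : I → I → ℝ a matrix satisfying A(σ i)(σ j) = A i j for all i,j ∈ I. Assume every i ∈ I has a finite σ-orbit and let N_i denote the cardinality of the orbit of i (equivalently, the minimal period of i under σ). Let s : I → ℝ satisfy s i > 0, s(σ i) = s i, and s i · A i j = s j · A j i for all i,j ∈ I. Define ε_j = 1 − ∑_{k=1}^{N_j−1} A j (σ^k j) and Â i j = ε_j · ∑_{k=0}^{N_j−1} A i (σ^k j). Then for all i,j ∈ I: (N_i · ε_i · s i) · Â i j = (N_j · ε_j · s j) · Â j i. -/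
/-- The orbit matrix `Â` of a `σ`-invariant symmetrizable
Borcherds–Cartan matrix `A` (with symmetrizing entries `s i > 0`, `σ`-invariant, so that
`s i · A i j = s j · A j i`) is again symmetrizable, with symmetrizing entries
`ŝ i = N i · ε i · s i`, where `N i` is the size (= minimal period) of the `σ`-orbit of `i`,
`ε j = 1 − ∑_{k=1}^{N j − 1} A j (σ^k j)` and
`Â i j = ε j · ∑_{k=0}^{N j − 1} A i (σ^k j)`. -/
theorem orbit_matrix_symmetrizable
    {I : Type*} (σ : Equiv.Perm I) (A : I → I → ℝ)
    (hAinv : ∀ i j : I, A (σ i) (σ j) = A i j)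
    (N : I → ℕ)
    (hNpos : ∀ i : I, 0 < N i)
    (hNfix : ∀ i : I, (σ ^ N i) i = i)
    (hNmin : ∀ (i : I) (m : ℕ), 0 < m → (σ ^ m) i = i → N i ≤ m)
    (s : I → ℝ)
    (hspos : ∀ i : I, 0 < s i)
    (hsinv : ∀ i : I, s (σ i) = s i)
    (hsym : ∀ i j : I, s i * A i j = s j * A j i)
    (ε : I → ℝ)
    (hε : ∀ j : I, ε j = 1 - ∑ k ∈ Finset.Ico 1 (N j), A j ((σ ^ k) j))
    (Ahat : I → I → ℝ)
    (hAhat : ∀ i j : I, Ahat i j = ε j * ∑ k ∈ Finset.range (N j), A i ((σ ^ k) j)) :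
    ∀ i j : I,
      ((N i : ℝ) * ε i * s i) * Ahat i j = ((N j : ℝ) * ε j * s j) * Ahat j i := by
  have row : ∀ (i j : I) (l : ℕ), ∑ k ∈ Finset.range (N j), A ((σ ^ l) i) ((σ ^ k) j)
      = ∑ k ∈ Finset.range (N j), A i ((σ ^ k) j) := by
    intro i j l
    induction l with
    | zero => simp
    | succ l ih =>
      rw [← ih]
      have h1 := Finset.sum_range_succ (fun k => A ((σ ^ (l + 1)) i) ((σ ^ k) j)) (N j)
      rw [Finset.sum_range_succ'] at h1
      simp only [hNfix, pow_zero, Equiv.Perm.coe_one, id_eq, pow_succ', Equiv.Perm.mul_apply,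
        hAinv] at h1 ⊢
      linarith
  have hs : ∀ (i : I) (l : ℕ), s ((σ ^ l) i) = s i := by
    intro i l
    induction l with
    | zero => simp
    | succ l ih => rw [pow_succ', Equiv.Perm.mul_apply, hsinv, ih]
  have dbl : ∀ i j : I, (N i : ℝ) * s i * ∑ k ∈ Finset.range (N j), A i ((σ ^ k) j)
      = ∑ l ∈ Finset.range (N i), ∑ k ∈ Finset.range (N j),
          s ((σ ^ l) i) * A ((σ ^ l) i) ((σ ^ k) j) := by
    intro i j
    simp only [← Finset.mul_sum, row, hs, Finset.sum_const, Finset.card_range, nsmul_eq_mul]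
    ring
  intro i j
  have key : (N i : ℝ) * s i * ∑ k ∈ Finset.range (N j), A i ((σ ^ k) j)
      = (N j : ℝ) * s j * ∑ k ∈ Finset.range (N i), A j ((σ ^ k) i) := by
    rw [dbl i j, dbl j i, Finset.sum_comm]
    exact Finset.sum_congr rfl fun _ _ => Finset.sum_congr rfl fun _ _ => hsym _ _
  rw [hAhat, hAhat]
  linear_combination (ε i * ε j) * key
end

section
/- Let I be a type, σ : I ≃ I a bijection, and A : I → I → ℝ a matrix satisfying A(σ i)(σ j) = A i j for all i,j ∈ I. Assume every i ∈ I has a finite σ-orbit and let N_i denote the cardinality of the orbit of i. Let s : I → ℝ satisfy s(σ i) = s i for all i. Define ε_j = 1 − ∑_{k=1}^{N_j−1} A j (σ^k j) and Â i j = ε_j · ∑_{k=0}^{N_j−1} A i (σ^k j). Then for all i,j ∈ I: ε_i · ε_j · ∑_{k=0}^{N_i−1} ∑_{l=0}^{N_j−1} s(σ^k i) · A (σ^k i) (σ^l j) = (N_i · ε_i · s i) · Â i j. -/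
/-- Lemma 8.1 restricted to simple roots.  For a `σ`-invariant matrix
`A` with `σ`-invariant weights `s`, writing `N i` for the size (= minimal period) of the
`σ`-orbit of `i`, `ε j = 1 − ∑_{k=1}^{N j − 1} A j (σ^k j)` and
`Â i j = ε j · ∑_{k=0}^{N j − 1} A i (σ^k j)`, one has
`ε i · ε j · ∑_{k=0}^{N i − 1} ∑_{l=0}^{N j − 1} s (σ^k i) · A (σ^k i) (σ^l j)
  = (N i · ε i · s i) · Â i j`. -/
theorem orbit_bilinear_form_identity
    {I : Type*} (σ : Equiv.Perm I) (A : I → I → ℝ)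
    (hAinv : ∀ i j : I, A (σ i) (σ j) = A i j)
    (N : I → ℕ)
    (hNpos : ∀ i : I, 0 < N i)
    (hNfix : ∀ i : I, (σ ^ N i) i = i)
    (hNmin : ∀ (i : I) (m : ℕ), 0 < m → (σ ^ m) i = i → N i ≤ m)
    (s : I → ℝ)
    (hsinv : ∀ i : I, s (σ i) = s i)
    (ε : I → ℝ)
    (hε : ∀ j : I, ε j = 1 - ∑ k ∈ Finset.Ico 1 (N j), A j ((σ ^ k) j))
    (Ahat : I → I → ℝ)
    (hAhat : ∀ i j : I, Ahat i j = ε j * ∑ k ∈ Finset.range (N j), A i ((σ ^ k) j)) :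
    ∀ i j : I,
      ε i * ε j *
          ∑ k ∈ Finset.range (N i), ∑ l ∈ Finset.range (N j),
            s ((σ ^ k) i) * A ((σ ^ k) i) ((σ ^ l) j)
        = ((N i : ℝ) * ε i * s i) * Ahat i j := by
  intro i j
  have hstep : ∀ x : I, ∑ l ∈ Finset.range (N j), A (σ x) ((σ ^ l) j)
      = ∑ l ∈ Finset.range (N j), A x ((σ ^ l) j) := by
    intro x
    have h1 := Finset.sum_range_succ (fun l => A (σ x) ((σ ^ l) j)) (N j)
    have h2 := Finset.sum_range_succ' (fun l => A (σ x) ((σ ^ l) j)) (N j)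
    simp only [pow_succ', Equiv.Perm.mul_apply, hAinv, hNfix, pow_zero,
      Equiv.Perm.one_apply] at h1 h2
    linarith
  have hT : ∀ k : ℕ, ∑ l ∈ Finset.range (N j), A ((σ ^ k) i) ((σ ^ l) j)
      = ∑ l ∈ Finset.range (N j), A i ((σ ^ l) j) := by
    intro k
    induction k with
    | zero => simp
    | succ k ih => rw [pow_succ', Equiv.Perm.mul_apply, hstep, ih]
  have hs : ∀ k : ℕ, s ((σ ^ k) i) = s i := by
    intro k
    induction k with
    | zero => simp
    | succ k ih => rw [pow_succ', Equiv.Perm.mul_apply, hsinv, ih]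
  simp only [← Finset.mul_sum, hT, hs, hAhat, Finset.sum_const, Finset.card_range,
    nsmul_eq_mul]
  ring
end
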